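/- For every n ≥ 1, the sum over all set partitions λ of [n] of i(λ)^2 equals (1/144)·((36n^2+24n−23)B_n + (72n^2+72n−260)B_{n+1} + (36n^2+156n+489)B_{n+2} − (180n+814)B_{n+3} + 225·B_{n+4}). -/

import Mathlib

open Finset

/-- Set partitions of `[n]`, modeled as finpartitions of `Fin n`. -/
abbrev SetPartition (n : ℕ) := Finpartition (Finset.univ : Finset (Fin n))

/-- The `n`-th Bell number: the number of set partitions of `[n]`. -/
def bell (n : ℕ) : ℕ := Fintype.card (SetPartition n)

/-- `i` and `j` lie in the same block of the partition. -/
def SameBlock {n : ℕ} (P : SetPartition n) (i j : Fin n) : Prop :=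
  ∃ b ∈ P.parts, i ∈ b ∧ j ∈ b

/-- `i` is the smallest element of its block. -/
def IsFirst {n : ℕ} (P : SetPartition n) (i : Fin n) : Prop :=
  ∀ j, SameBlock P i j → i ≤ j

/-- `i` is the largest element of its block. -/
def IsLast {n : ℕ} (P : SetPartition n) (i : Fin n) : Prop :=
  ∀ j, SameBlock P i j → j ≤ i

/-- `(i, j)` is an arc: `i < j`, both in the same block, and `j` is the smallest
element of that block greater than `i`. -/
def IsArc {n : ℕ} (P : SetPartition n) (i j : Fin n) : Prop :=
  i < j ∧ SameBlock P i j ∧ ∀ k, i < k → k < j → ¬ SameBlock P i k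

/-- The dimension exponent `d(λ) = Σ_blocks (max - min + 1) - n`. -/
def dimExp {n : ℕ} (P : SetPartition n) : ℤ :=
  (∑ b ∈ P.parts.attach,
      (((b.1.max' (P.nonempty_of_mem_parts b.2)).val : ℤ)
        - ((b.1.min' (P.nonempty_of_mem_parts b.2)).val : ℤ) + 1)) - n

/-- The intertwining exponent (number of 2-crossings): the number of pairs of arcs
`(i₁,j₁), (i₂,j₂)` with `i₁ < i₂ < j₁ < j₂`. -/
noncomputable def inter {n : ℕ} (P : SetPartition n) : ℕ :=
  Set.ncard {q : (Fin n × Fin n) × (Fin n × Fin n) |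
    IsArc P q.1.1 q.1.2 ∧ IsArc P q.2.1 q.2.2 ∧
    q.1.1 < q.2.1 ∧ q.2.1 < q.1.2 ∧ q.1.2 < q.2.2}

/-- The number of ways to complete, by reading `n` further points, a partial set partition with `k`
unfinished blocks. (The recursion is used for every integer `k`, the combinatorial meaning is
that of `0 ≤ k`.) -/
def completions : ℕ → ℤ → ℚ
  | 0, k => if k = 0 then 1 else 0
  | n + 1, k =>
    completions n (k + 1) + (1 + k) * completions n k + k * completions n (k - 1)

/-- The sum over all completions of the number of crossings that they add. -/
def completionsInter (n : ℕ) (k : ℤ) : ℚ :=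
  (1 / 4) * ((-2 * k^2 + 2 * k * n + 2 * k) * completions n (k - 1)
    + (-2 * k^2 + 2 * k * n - 6 * k + 4 * n) * completions n k
    + (-8 * k + 2 * n - 6) * completions n (k + 1)
    - 5 * completions n (k + 2))

/-- The sum over all completions of the square of the number of crossings that they add. -/
def completionsInterSq (n : ℕ) (k : ℤ) : ℚ :=
  (1 / 144) * ((36 * k^4 - 72 * k^3 * n - 120 * k^3 + 36 * k^2 * n^2 + 156 * k^2 * n
      + 108 * k^2 - 36 * k * n^2 - 84 * k * n - 24 * k) * completions n (k - 2)
    + (72 * k^4 - 144 * k^3 * n + 96 * k^3 + 72 * k^2 * n^2 - 192 * k^2 * n + 144 * k^2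
      + 108 * k * n^2 - 204 * k * n - 312 * k) * completions n (k - 1)
    + (36 * k^4 - 72 * k^3 * n + 504 * k^3 + 36 * k^2 * n^2 - 708 * k^2 * n + 1116 * k^2
      + 216 * k * n^2 - 1104 * k * n + 648 * k + 180 * n^2 - 492 * n) * completions n k
    + (288 * k^3 - 360 * k^2 * n + 1836 * k^2 + 72 * k * n^2 - 1452 * k * n + 3060 * k
      + 180 * n^2 - 1260 * n + 1392) * completions n (k + 1)
    + (756 * k^2 - 468 * k * n + 2844 * k + 36 * n^2 - 924 * n + 2580) * completions n (k + 2)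
    + (720 * k - 180 * n + 1436) * completions n (k + 3)
    + 225 * completions n (k + 4))

lemma completions_succ (n : ℕ) (k : ℤ) :
    completions (n + 1) k =
      completions n (k + 1) + (1 + k) * completions n k + k * completions n (k - 1) := rfl

lemma completionsInter_succ (n : ℕ) (k : ℤ) :
    completionsInter (n + 1) k =
      completionsInter n (k + 1) + (1 + k) * completionsInter n k + k * completionsInter n (k - 1)
      + k * (k - 1) / 2 * (completions n k + completions n (k - 1)) := by
  simp only [completionsInter, completions_succ]
  push_cast
  ring_nf

lemma completionsInterSq_succ (n : ℕ) (k : ℤ) :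
    completionsInterSq (n + 1) k =
      completionsInterSq n (k + 1) + (1 + k) * completionsInterSq n k
      + k * completionsInterSq n (k - 1)
      + k * (k - 1) * (completionsInter n k + completionsInter n (k - 1))
      + k * (k - 1) * (2 * k - 1) / 6 * (completions n k + completions n (k - 1)) := by
  simp only [completionsInter, completionsInterSq, completions_succ]
  push_cast
  ring_nf

lemma completionsInter_zero (k : ℕ) : completionsInter 0 k = 0 := by
  rcases k with _ | _ | k
  · norm_num [completionsInter, completions]
  · norm_num [completionsInter, completions]
  · have h (j : ℤ) (hj : -1 ≤ j) : completions 0 ((k + 1 + 1 : ℕ) + j) = 0 :=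
      if_neg (by push_cast; omega)
    have h0 := h 0 (by norm_num)
    rw [add_zero] at h0
    simp only [completionsInter, sub_eq_add_neg, h _ (show (-1 : ℤ) ≤ -1 by norm_num), h0,
      h 1 (by norm_num), h 2 (by norm_num)]
    ring

lemma completionsInterSq_zero (k : ℕ) : completionsInterSq 0 k = 0 := by
  rcases k with _ | _ | _ | k
  · norm_num [completionsInterSq, completions]
  · norm_num [completionsInterSq, completions]
  · norm_num [completionsInterSq, completions]
  · have h (j : ℤ) (hj : -2 ≤ j) : completions 0 ((k + 1 + 1 + 1 : ℕ) + j) = 0 :=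
      if_neg (by push_cast; omega)
    have h0 := h 0 (by norm_num)
    rw [add_zero] at h0
    simp only [completionsInterSq, sub_eq_add_neg, h _ (show (-2 : ℤ) ≤ -2 by norm_num),
      h _ (show (-2 : ℤ) ≤ -1 by norm_num), h0, h 1 (by norm_num), h 2 (by norm_num),
      h 3 (by norm_num), h 4 (by norm_num)]
    ring

/-- The closed formula, with `completions n 0` in the role of the Bell numbers. -/
lemma completionsInterSq_at_zero (n : ℕ) :
    completionsInterSq n 0 =
      (1 / 144) * ((36 * (n : ℚ) ^ 2 + 24 * n - 23) * completions n 0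
        + (72 * (n : ℚ) ^ 2 + 72 * n - 260) * completions (n + 1) 0
        + (36 * (n : ℚ) ^ 2 + 156 * n + 489) * completions (n + 2) 0
        - (180 * (n : ℚ) + 814) * completions (n + 3) 0
        + 225 * completions (n + 4) 0) := by
  simp only [completionsInterSq, completions_succ]
  push_cast
  ring_nf

/-- A set of arcs, no two of which share their start or their end, together with a set of points,
not the start of any of these arcs, at which an unfinished arc starts. -/
def IsDiagram (x : Finset (ℕ × ℕ) × Finset ℕ) : Prop :=
  (∀ a ∈ x.1, a.1 < a.2) ∧ (∀ a ∈ x.1, ∀ b ∈ x.1, a.1 = b.1 → a = b) ∧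
    (∀ a ∈ x.1, ∀ b ∈ x.1, a.2 = b.2 → a = b) ∧ ∀ a ∈ x.1, a.1 ∉ x.2

open Classical in
/-- The finite set of all diagrams with arcs in `[0, n) × [0, m)` and unfinished arcs
starting in `[0, n)`. -/
noncomputable def diagrams (n m : ℕ) : Finset (Finset (ℕ × ℕ) × Finset ℕ) :=
  {x ∈ (range n ×ˢ range m).powerset ×ˢ (range n).powerset | IsDiagram x}

lemma mem_diagrams {n m : ℕ} {x : Finset (ℕ × ℕ) × Finset ℕ} :
    x ∈ diagrams n m ↔
      (∀ a ∈ x.1, a.1 < n ∧ a.2 < m) ∧ (∀ o ∈ x.2, o < n) ∧ IsDiagram x := by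
  simp only [diagrams, mem_filter, mem_product, mem_powerset, subset_iff, mem_range, and_assoc]

/-- The number of crossings, where unfinished arcs count as arcs ending at infinity (with no
crossings among themselves). -/
def crossings (x : Finset (ℕ × ℕ) × Finset ℕ) : ℕ :=
  (∑ a ∈ x.1, ∑ b ∈ x.1, if a.1 < b.1 ∧ b.1 < a.2 ∧ a.2 < b.2 then 1 else 0)
    + ∑ a ∈ x.1, ∑ o ∈ x.2, if a.1 < o ∧ o < a.2 then 1 else 0

lemma crossings_open {A : Finset (ℕ × ℕ)} {O : Finset ℕ} {n : ℕ}
    (hA : ∀ a ∈ A, a.2 ≤ n) (hn : n ∉ O) : crossings (A, insert n O) = crossings (A, O) := by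
  simp only [crossings, sum_insert hn]
  congr 1
  refine sum_congr rfl fun a ha => ?_
  rw [if_neg (by have := hA a ha; omega), zero_add]

lemma crossings_close {A : Finset (ℕ × ℕ)} {O : Finset ℕ} {n i : ℕ}
    (hA : ∀ a ∈ A, a.2 < n) (hO : ∀ o ∈ O, o < n) (hi : i ∈ O) :
    crossings (insert (i, n) A, O.erase i) = crossings (A, O) + #{o ∈ O | i < o} := by
  have hin : (i, n) ∉ A := fun h => lt_irrefl _ (hA _ h)
  simp only [crossings, sum_insert hin]
  have h1 : ∑ b ∈ A, (if i < b.1 ∧ b.1 < n ∧ n < b.2 then 1 else 0) = 0 :=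
    sum_eq_zero fun b hb => if_neg (by have := hA b hb; omega)
  have h2 : ∑ o ∈ O.erase i, (if i < o ∧ o < n then 1 else 0) = #{o ∈ O | i < o} := by
    rw [card_filter, ← sum_erase (a := i) O (by simp)]
    refine sum_congr rfl fun o ho => ?_
    simp [hO o (mem_of_mem_erase ho)]
  have h3 : ∀ a ∈ A, (if a.1 < i ∧ i < a.2 ∧ a.2 < n then 1 else 0)
      + ∑ o ∈ O.erase i, (if a.1 < o ∧ o < a.2 then 1 else 0)
      = ∑ o ∈ O, if a.1 < o ∧ o < a.2 then 1 else 0 := by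
    intro a ha
    rw [← add_sum_erase O _ hi]
    simp [hA a ha]
  rw [h1, h2, sum_add_distrib, ← sum_congr rfl h3, sum_add_distrib]
  simp
  ring

lemma sum_card_filter_lt (O : Finset ℕ) (g : ℕ → ℚ) :
    ∑ i ∈ O, g #{o ∈ O | i < o} = ∑ r ∈ range #O, g r := by
  induction O using Finset.induction_on_min with
  | empty => simp
  | insert a s ha ih =>
    have has : a ∉ s := fun h => lt_irrefl _ (ha a h)
    rw [sum_insert has, card_insert_of_notMem has, sum_range_succ, ← ih, add_comm]
    congr 1
    · refine sum_congr rfl fun i hi => ?_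
      rw [filter_insert, if_neg (ha i hi).not_gt]
    · rw [filter_insert, if_neg (lt_irrefl a), filter_true_of_mem ha]

lemma sum_diagrams_open (n : ℕ) (H : Finset (ℕ × ℕ) × Finset ℕ → ℚ) :
    ∑ x ∈ diagrams (n + 1) (n + 1), H x =
      ∑ x ∈ diagrams n (n + 1), (H x + H (x.1, insert n x.2)) := by
  rw [sum_add_distrib, ← sum_filter_not_add_sum_filter _ (fun x => n ∈ x.2)]
  congr 1
  · refine sum_congr ?_ fun _ _ => rfl
    ext x
    simp only [mem_filter, mem_diagrams, IsDiagram]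
    constructor
    · rintro ⟨⟨h1, h2, h3, h4⟩, h5⟩
      refine ⟨fun a ha => ?_, fun o ho => ?_, h3, h4⟩
      · have := h1 a ha
        have := h3 a ha
        omega
      · have := h2 o ho
        have : o ≠ n := fun h => h5 (h ▸ ho)
        omega
    · rintro ⟨h1, h2, h3, h4⟩
      exact ⟨⟨fun a ha => ⟨(h1 a ha).1.trans n.lt_succ_self, (h1 a ha).2⟩,
        fun o ho => (h2 o ho).trans n.lt_succ_self, h3, h4⟩, fun h => lt_irrefl _ (h2 _ h)⟩
  · symm
    refine sum_bij' (fun x _ => (x.1, insert n x.2)) (fun x _ => (x.1, x.2.erase n)) ?_ ?_ ?_ ?_ ?_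
    · rintro ⟨A, O⟩ hx
      simp only [mem_filter, mem_diagrams, IsDiagram] at hx ⊢
      obtain ⟨h1, h2, h3, h4, h5, h6⟩ := hx
      refine ⟨⟨fun a ha => ?_, ?_, h3, h4, h5, fun a ha => ?_⟩, mem_insert_self _ _⟩
      · have := h1 a ha
        omega
      · simp only [mem_insert, forall_eq_or_imp]
        exact ⟨n.lt_succ_self, fun o ho => (h2 o ho).trans n.lt_succ_self⟩
      · rw [mem_insert, not_or]
        exact ⟨(h1 a ha).1.ne, h6 a ha⟩
    · rintro ⟨A, O⟩ hx
      simp only [mem_filter, mem_diagrams, IsDiagram] at hx ⊢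
      obtain ⟨⟨h1, h2, h3, h4, h5, h6⟩, h7⟩ := hx
      refine ⟨fun a ha => ?_, fun o ho => ?_, h3, h4, h5,
        fun a ha h => h6 a ha (mem_of_mem_erase h)⟩
      · have := h1 a ha
        have := h3 a ha
        omega
      · rw [mem_erase] at ho
        have := h2 o ho.2
        omega
    · rintro ⟨A, O⟩ hx
      have : n ∉ O := fun h => lt_irrefl _ ((mem_diagrams.1 hx).2.1 _ h)
      simp [this]
    · rintro ⟨A, O⟩ hx
      simp [insert_erase (mem_filter.1 hx).2]
    · intros
      rfl

lemma sum_diagrams_close (n : ℕ) (H : Finset (ℕ × ℕ) × Finset ℕ → ℚ) :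
    ∑ x ∈ diagrams n (n + 1), H x =
      ∑ x ∈ diagrams n n, (H x + ∑ i ∈ x.2, H (insert (i, n) x.1, x.2.erase i)) := by
  classical
  rw [sum_add_distrib, ← sum_filter_not_add_sum_filter _ (fun x => ∃ i, (i, n) ∈ x.1)]
  congr 1
  · refine sum_congr ?_ fun _ _ => rfl
    ext x
    simp only [mem_filter, mem_diagrams]
    constructor
    · rintro ⟨⟨h1, h2⟩, h5⟩
      refine ⟨fun a ha => ⟨(h1 a ha).1, ?_⟩, h2⟩
      have := h1 a ha
      have : a.2 ≠ n := fun h => h5 ⟨a.1, h ▸ ha⟩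
      omega
    · rintro ⟨h1, h2⟩
      exact ⟨⟨fun a ha => ⟨(h1 a ha).1, (h1 a ha).2.trans n.lt_succ_self⟩, h2⟩,
        fun ⟨i, hi⟩ => lt_irrefl _ (h1 _ hi).2⟩
  · rw [sum_sigma']
    symm
    refine sum_bij (fun y _ => (insert (y.2, n) y.1.1, y.1.2.erase y.2)) ?_ ?_ ?_ ?_
    · rintro ⟨⟨A, O⟩, i⟩ hx
      simp only [mem_sigma, mem_filter, mem_diagrams, IsDiagram] at hx ⊢
      obtain ⟨⟨h1, h2, h3, h4, h5, h6⟩, h7⟩ := hx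
      have hin := h2 i h7
      refine ⟨⟨?_, fun o ho => h2 o (mem_of_mem_erase ho), ?_, ?_, ?_, ?_⟩, i,
        mem_insert_self _ _⟩
      · simp only [mem_insert, forall_eq_or_imp]
        exact ⟨⟨hin, n.lt_succ_self⟩, fun a ha => ⟨(h1 a ha).1, (h1 a ha).2.trans n.lt_succ_self⟩⟩
      · simp only [mem_insert, forall_eq_or_imp]
        exact ⟨hin, h3⟩
      · simp only [mem_insert, forall_eq_or_imp]
        exact ⟨⟨fun _ => trivial, fun a ha h => absurd h7 (h ▸ h6 a ha)⟩,
          fun a ha => ⟨fun h => absurd h7 (h ▸ h6 a ha), h4 a ha⟩⟩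
      · simp only [mem_insert, forall_eq_or_imp]
        exact ⟨⟨fun _ => trivial, fun a ha h => absurd h (h1 a ha).2.ne'⟩,
          fun a ha => ⟨fun h => absurd h (h1 a ha).2.ne, h5 a ha⟩⟩
      · simp only [mem_insert, forall_eq_or_imp]
        exact ⟨notMem_erase _ _, fun a ha h => h6 a ha (mem_of_mem_erase h)⟩
    · rintro ⟨⟨A, O⟩, i⟩ hx ⟨⟨B, Q⟩, j⟩ hy hxy
      simp only [mem_sigma, mem_diagrams] at hx hy
      simp only [Prod.mk.injEq] at hxy
      have hiA : ∀ i, (i, n) ∉ A := fun i h => lt_irrefl _ (hx.1.1 _ h).2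
      have hjB : ∀ j, (j, n) ∉ B := fun j h => lt_irrefl _ (hy.1.1 _ h).2
      have hij : i = j := by
        have : (i, n) ∈ insert (j, n) B := hxy.1 ▸ mem_insert_self _ _
        simpa [hjB] using this
      subst hij
      have hAB : A = B := by
        rw [← erase_insert (hiA i), hxy.1, erase_insert (hjB i)]
      have hOQ : O = Q := by
        rw [← insert_erase hx.2, hxy.2, insert_erase hy.2]
      rw [hAB, hOQ]
    · rintro ⟨A, O⟩ hx
      simp only [mem_filter, mem_diagrams, IsDiagram] at hx
      obtain ⟨⟨h1, h2, h3, h4, h5, h6⟩, i, hi⟩ := hx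
      have hiO : i ∉ O := h6 _ hi
      refine ⟨⟨(A.erase (i, n), insert i O), i⟩, ?_, ?_⟩
      · simp only [mem_sigma, mem_diagrams, IsDiagram]
        refine ⟨⟨fun a ha => ⟨(h1 a (mem_of_mem_erase ha)).1, ?_⟩, ?_,
          fun a ha => h3 a (mem_of_mem_erase ha),
          fun a ha b hb => h4 a (mem_of_mem_erase ha) b (mem_of_mem_erase hb),
          fun a ha b hb => h5 a (mem_of_mem_erase ha) b (mem_of_mem_erase hb),
          fun a ha => ?_⟩, mem_insert_self _ _⟩
        · rw [mem_erase] at ha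
          have := (h1 a ha.2).2
          have : a.2 ≠ n := fun h => ha.1 (h5 a ha.2 _ hi h)
          omega
        · simp only [mem_insert, forall_eq_or_imp]
          exact ⟨(h1 _ hi).1, h2⟩
        · rw [mem_erase] at ha
          rw [mem_insert, not_or]
          exact ⟨fun h => ha.1 (h4 a ha.2 _ hi h), h6 a ha.2⟩
      · simp [insert_erase hi, erase_insert hiO]
    · intros
      rfl

/-- Reading one more point of a diagram, in terms of the numbers of crossings and of unfinished
arcs. -/
lemma sum_diagrams_succ (n : ℕ) (h : ℕ → ℕ → ℚ) :
    ∑ x ∈ diagrams (n + 1) (n + 1), h (crossings x) #x.2 =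
      ∑ x ∈ diagrams n n, (h (crossings x) #x.2 + h (crossings x) (#x.2 + 1)
        + ∑ r ∈ range #x.2, (h (crossings x + r) (#x.2 - 1) + h (crossings x + r) #x.2)) := by
  rw [sum_diagrams_open]
  have h1 : ∀ x ∈ diagrams n (n + 1),
      h (crossings x) #x.2 + h (crossings (x.1, insert n x.2)) #(insert n x.2)
        = h (crossings x) #x.2 + h (crossings x) (#x.2 + 1) := by
    rintro ⟨A, O⟩ hx
    rw [mem_diagrams] at hx
    have hn : n ∉ O := fun h => lt_irrefl _ (hx.2.1 _ h)
    rw [crossings_open (fun a ha => Nat.le_of_lt_succ (hx.1 a ha).2) hn, card_insert_of_notMem hn]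
  rw [sum_congr rfl h1, sum_diagrams_close n (fun x => h (crossings x) #x.2
    + h (crossings x) (#x.2 + 1))]
  refine sum_congr rfl ?_
  rintro ⟨A, O⟩ hx
  rw [mem_diagrams] at hx
  dsimp only
  rw [← sum_card_filter_lt O]
  congr 1
  refine sum_congr rfl fun i hi => ?_
  rw [crossings_close (fun a ha => (hx.1 a ha).2) hx.2.1 hi, card_erase_of_mem hi,
    Nat.sub_add_cancel (card_pos.2 ⟨i, hi⟩)]

lemma sum_range_id_cast (k : ℕ) : ∑ r ∈ range k, (r : ℚ) = k * (k - 1) / 2 := by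
  induction k with
  | zero => simp
  | succ k ih => rw [sum_range_succ, ih]; push_cast; ring

lemma sum_range_sq_cast (k : ℕ) :
    ∑ r ∈ range k, (r : ℚ) ^ 2 = k * (k - 1) * (2 * k - 1) / 6 := by
  induction k with
  | zero => simp
  | succ k ih => rw [sum_range_succ, ih]; push_cast; ring

/-- `completions`, `completionsInter` and `completionsInterSq` describe the sums of `α + β i²`
over all diagrams on `m + n` points without unfinished arcs by sums over diagrams on
`m` points. -/
lemma sum_diagrams_add (α β : ℚ) (n m : ℕ) :
    ∑ x ∈ diagrams (m + n) (m + n), (if #x.2 = 0 then α + β * (crossings x : ℚ) ^ 2 else 0) =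
      ∑ x ∈ diagrams m m, (α * completions n #x.2 + β * ((crossings x : ℚ) ^ 2 * completions n #x.2
        + 2 * crossings x * completionsInter n #x.2 + completionsInterSq n #x.2)) := by
  induction n generalizing m with
  | zero =>
    refine sum_congr rfl fun x _ => ?_
    rw [completionsInter_zero, completionsInterSq_zero]
    by_cases h : #x.2 = 0 <;> simp [completions, h]
  | succ n ih =>
    rw [← add_assoc, add_right_comm, ih (m + 1), sum_diagrams_succ m fun s k =>
      α * completions n k + β * ((s : ℚ) ^ 2 * completions n k
        + 2 * s * completionsInter n k + completionsInterSq n k)]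
    refine sum_congr rfl fun x _ => ?_
    rw [completions_succ, completionsInter_succ, completionsInterSq_succ]
    generalize crossings x = s
    generalize #x.2 = k
    rcases k with _ | k
    · simp
      ring
    · have e (a b c d e' f : ℚ) (s r : ℚ) :
          α * a + β * ((s + r) ^ 2 * a + 2 * (s + r) * b + c)
            + (α * d + β * ((s + r) ^ 2 * d + 2 * (s + r) * e' + f))
          = (α * a + β * (s ^ 2 * a + 2 * s * b + c) + (α * d + β * (s ^ 2 * d + 2 * s * e' + f)))
            + r * (β * (2 * s * (a + d) + 2 * (b + e'))) + r ^ 2 * (β * (a + d)) := by ring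
      simp only [Nat.cast_add s, e, sum_add_distrib, ← sum_mul, sum_range_id_cast,
        sum_range_sq_cast, sum_const, card_range, nsmul_eq_mul, Nat.add_sub_cancel]
      push_cast
      rw [add_sub_cancel_right (k : ℤ) 1]
      ring

lemma sum_diagrams (α β : ℚ) (n : ℕ) :
    ∑ x ∈ diagrams n n, (if #x.2 = 0 then α + β * (crossings x : ℚ) ^ 2 else 0) =
      α * completions n 0 + β * completionsInterSq n 0 := by
  have h0 : diagrams 0 0 = {(∅, ∅)} := by
    ext ⟨A, O⟩
    simp only [mem_diagrams, IsDiagram, not_lt_zero, mem_singleton, Prod.mk.injEq, and_self,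
      eq_empty_iff_forall_notMem]
    exact ⟨fun h => ⟨h.1, h.2.1⟩, fun h => ⟨h.1, h.2, fun a ha => absurd ha (h.1 a),
      fun a ha => absurd ha (h.1 a), fun a ha => absurd ha (h.1 a), fun a ha => absurd ha (h.1 a)⟩⟩
  have := sum_diagrams_add α β n 0
  rw [zero_add] at this
  rw [this, h0]
  simp [crossings]

lemma sameBlock_iff {n : ℕ} {P : SetPartition n} {i j : Fin n} :
    SameBlock P i j ↔ P.part i = P.part j := by
  rw [← P.mem_part_iff_part_eq_part (mem_univ i) (mem_univ j), P.mem_part_iff_exists, SameBlock]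

lemma setPartition_ext {n : ℕ} {P Q : SetPartition n}
    (h : ∀ i j, SameBlock P i j ↔ SameBlock Q i j) : P = Q := by
  have hpart (i : Fin n) : P.part i = Q.part i := by
    ext j
    rw [P.mem_part_iff_part_eq_part (mem_univ _) (mem_univ _),
      Q.mem_part_iff_part_eq_part (mem_univ _) (mem_univ _), ← sameBlock_iff, ← sameBlock_iff, h]
  refine Finpartition.ext (Finset.ext fun b => ⟨fun hb => ?_, fun hb => ?_⟩)
  · obtain ⟨i, hi⟩ := P.nonempty_of_mem_parts hb
    rw [← P.part_eq_of_mem hb hi, hpart]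
    exact Q.part_mem.2 (mem_univ i)
  · obtain ⟨i, hi⟩ := Q.nonempty_of_mem_parts hb
    rw [← Q.part_eq_of_mem hb hi, ← hpart]
    exact P.part_mem.2 (mem_univ i)

lemma exists_isArc_of_lt {n : ℕ} {P : SetPartition n} {i j : Fin n} (hij : i < j)
    (h : SameBlock P i j) : ∃ k, IsArc P i k ∧ k ≤ j := by
  classical
  obtain ⟨k, hk, hmin⟩ := exists_min_image {k | i < k ∧ SameBlock P i k} id ⟨j, by simp [hij, h]⟩
  simp only [mem_filter, mem_univ, true_and, id] at hk hmin
  exact ⟨k, ⟨hk.1, hk.2, fun l hl hlk hs => (hmin l ⟨hl, hs⟩).not_gt hlk⟩, hmin j ⟨hij, h⟩⟩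

lemma sameBlock_of_isArc_imp {n : ℕ} {P Q : SetPartition n}
    (h : ∀ i j, IsArc P i j → IsArc Q i j) {i j : Fin n} (hij : i ≤ j)
    (hP : SameBlock P i j) : SameBlock Q i j := by
  rcases hij.eq_or_lt with rfl | hlt
  · rw [sameBlock_iff]
  · obtain ⟨k, hk, hkj⟩ := exists_isArc_of_lt hlt hP
    have hkP : SameBlock P k j := by
      rw [sameBlock_iff] at hP ⊢
      rw [← hP, sameBlock_iff.1 hk.2.1]
    have hkQ := sameBlock_of_isArc_imp h hkj hkP
    rw [sameBlock_iff] at hkQ ⊢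
    rw [← hkQ, sameBlock_iff.1 (h i k hk).2.1]
termination_by j.val - i.val
decreasing_by
  have := hk.1
  omega

lemma setPartition_ext_isArc {n : ℕ} {P Q : SetPartition n}
    (h : ∀ i j, IsArc P i j ↔ IsArc Q i j) : P = Q := by
  refine setPartition_ext fun i j => ?_
  rcases le_total i j with hij | hij
  · exact ⟨sameBlock_of_isArc_imp (fun i j => (h i j).1) hij,
      sameBlock_of_isArc_imp (fun i j => (h i j).2) hij⟩
  · rw [sameBlock_iff, sameBlock_iff, eq_comm, @eq_comm _ (Q.part i), ← sameBlock_iff,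
      ← sameBlock_iff]
    exact ⟨sameBlock_of_isArc_imp (fun i j => (h i j).1) hij,
      sameBlock_of_isArc_imp (fun i j => (h i j).2) hij⟩

lemma IsArc.right_unique {n : ℕ} {P : SetPartition n} {i j k : Fin n} (hj : IsArc P i j)
    (hk : IsArc P i k) : j = k :=
  le_antisymm (not_lt.1 fun h => hj.2.2 k hk.1 h hk.2.1) (not_lt.1 fun h => hk.2.2 j hj.1 h hj.2.1)

lemma IsArc.left_unique {n : ℕ} {P : SetPartition n} {i j k : Fin n} (hi : IsArc P i k)
    (hj : IsArc P j k) : i = j := by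
  have hij : SameBlock P i j :=
    sameBlock_iff.2 ((sameBlock_iff.1 hi.2.1).trans (sameBlock_iff.1 hj.2.1).symm)
  have hji : SameBlock P j i := sameBlock_iff.2 (sameBlock_iff.1 hij).symm
  exact le_antisymm (not_lt.1 fun h => hj.2.2 i h hi.1 hji) (not_lt.1 fun h => hi.2.2 j h hj.1 hij)

/-- Every relation that looks like the arcs of a set partition is the arc relation of one. -/
lemma exists_isArc_iff {n : ℕ} (r : Fin n → Fin n → Prop) (hlt : ∀ i j, r i j → i < j)
    (hr : ∀ i j k, r i j → r i k → j = k) (hl : ∀ i j k, r i k → r j k → i = j) :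
    ∃ P : SetPartition n, ∀ i j, IsArc P i j ↔ r i j := by
  classical
  have hle (i j : Fin n) (h : Relation.ReflTransGen r i j) : i ≤ j := by
    induction h with
    | refl => exact le_rfl
    | tail _ h ih => exact ih.trans (hlt _ _ h).le
  let s : Setoid (Fin n) :=
    { r := fun i j => Relation.ReflTransGen r i j ∨ Relation.ReflTransGen r j i
      iseqv :=
        { refl := fun i => Or.inl .refl
          symm := Or.symm
          trans := by
            rintro i j k (h1 | h1) (h2 | h2)
            · exact Or.inl (h1.trans h2)
            · have := Relation.ReflTransGen.total_of_right_unique (r := Function.swap r)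
                (fun a b c hb hc => hl _ _ _ hb hc) h1.swap h2.swap
              exact this.elim (fun h => Or.inr (Relation.reflTransGen_swap.1 h))
                (fun h => Or.inl (Relation.reflTransGen_swap.1 h))
            · exact Relation.ReflTransGen.total_of_right_unique
                (fun a b c hb hc => hr _ _ _ hb hc) h1 h2
            · exact Or.inr (h2.trans h1) } }
  let P : SetPartition n := Finpartition.ofSetoid s
  have hP (i j : Fin n) : SameBlock P i j ↔
      Relation.ReflTransGen r i j ∨ Relation.ReflTransGen r j i := by
    rw [sameBlock_iff, eq_comm, ← P.mem_part_iff_part_eq_part (mem_univ j) (mem_univ i)]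
    exact Finpartition.mem_part_ofSetoid_iff_rel
  have hPlt (i j : Fin n) (hij : i < j) (h : SameBlock P i j) : ∃ k, r i k ∧ k ≤ j ∧
      SameBlock P k j := by
    rcases (hP i j).1 h with h | h
    · rcases h.cases_head with h | ⟨k, hk, hkj⟩
      · exact absurd h hij.ne
      · exact ⟨k, hk, hle _ _ hkj, (hP k j).2 (Or.inl hkj)⟩
    · exact absurd (hle _ _ h) hij.not_ge
  refine ⟨P, fun i j => ⟨fun h => ?_, fun h => ⟨hlt _ _ h, (hP i j).2 (Or.inl (.single h)), ?_⟩⟩⟩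
  · obtain ⟨k, hk, hkj, -⟩ := hPlt i j h.1 h.2.1
    rcases hkj.eq_or_lt with rfl | hkj
    · exact hk
    · exact absurd ((hP i k).2 (Or.inl (.single hk))) (h.2.2 k (hlt _ _ hk) hkj)
  · intro k hik hkj hs
    obtain ⟨l, hl, hlk, -⟩ := hPlt i k hik hs
    rw [hr _ _ _ hl h] at hlk
    exact hlk.not_gt hkj

open Classical in
/-- The arcs of a set partition of `[n]`, as pairs of natural numbers. -/
noncomputable def arcSet {n : ℕ} (P : SetPartition n) : Finset (ℕ × ℕ) :=
  ({q | IsArc P q.1 q.2} : Finset (Fin n × Fin n)).image (Prod.map Fin.val Fin.val)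

lemma mem_arcSet {n : ℕ} {P : SetPartition n} {a : ℕ × ℕ} :
    a ∈ arcSet P ↔ ∃ i j, IsArc P i j ∧ (i.val, j.val) = a := by
  simp [arcSet]

lemma mk_mem_arcSet {n : ℕ} {P : SetPartition n} {i j : Fin n} :
    (i.val, j.val) ∈ arcSet P ↔ IsArc P i j := by
  rw [mem_arcSet]
  constructor
  · rintro ⟨k, l, h, hkl⟩
    rw [Prod.mk.injEq, Fin.val_inj, Fin.val_inj] at hkl
    rwa [← hkl.1, ← hkl.2]
  · exact fun h => ⟨i, j, h, rfl⟩

lemma inter_eq_crossings {n : ℕ} (P : SetPartition n) : inter P = crossings (arcSet P, ∅) := by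
  simp only [crossings, sum_empty, sum_const_zero, add_zero]
  rw [← sum_product' (arcSet P) (arcSet P)
    (fun a b => if a.1 < b.1 ∧ b.1 < a.2 ∧ a.2 < b.2 then 1 else 0), ← card_filter,
    ← Set.ncard_coe_finset, inter]
  have hinj : Function.Injective (Prod.map (Prod.map Fin.val Fin.val) (Prod.map Fin.val Fin.val) :
      (Fin n × Fin n) × (Fin n × Fin n) → (ℕ × ℕ) × (ℕ × ℕ)) :=
    (Fin.val_injective.prodMap Fin.val_injective).prodMap
      (Fin.val_injective.prodMap Fin.val_injective)
  rw [← Set.ncard_image_of_injective _ hinj]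
  congr 1
  ext ⟨a, b⟩
  simp only [Set.mem_image, Set.mem_ofPred_eq, coe_filter, mem_product, mem_arcSet]
  constructor
  · rintro ⟨⟨⟨i, j⟩, k, l⟩, ⟨h1, h2, h3⟩, h4⟩
    simp only [Prod.map_apply, Prod.mk.injEq] at h4
    rw [← h4.1, ← h4.2]
    exact ⟨⟨⟨i, j, h1, rfl⟩, k, l, h2, rfl⟩, h3⟩
  · rintro ⟨⟨⟨i, j, h1, rfl⟩, k, l, h2, rfl⟩, h3⟩
    exact ⟨((i, j), k, l), ⟨h1, h2, h3⟩, rfl⟩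

/-- Set partitions correspond to the diagrams without unfinished arcs. -/
lemma sum_setPartition (n : ℕ) (g : ℕ → ℚ) :
    ∑ P : SetPartition n, g (inter P) =
      ∑ x ∈ diagrams n n, if #x.2 = 0 then g (crossings x) else 0 := by
  rw [← sum_filter]
  refine sum_bij (fun P _ => (arcSet P, ∅)) (fun P _ => ?_) (fun P _ Q _ h => ?_) ?_
    fun P _ => by rw [inter_eq_crossings]
  · simp only [mem_filter, mem_diagrams, IsDiagram, card_empty, notMem_empty, not_false_eq_true,
      implies_true, and_true, false_imp_iff, true_and]
    refine ⟨fun a ha => ?_, fun a ha => ?_, fun a ha b hb hab => ?_, fun a ha b hb hab => ?_⟩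
    · obtain ⟨i, j, h, rfl⟩ := mem_arcSet.1 ha
      exact ⟨i.isLt, j.isLt⟩
    · obtain ⟨i, j, h, rfl⟩ := mem_arcSet.1 ha
      exact h.1
    · obtain ⟨i, j, h, rfl⟩ := mem_arcSet.1 ha
      obtain ⟨k, l, h', rfl⟩ := mem_arcSet.1 hb
      obtain rfl : i = k := Fin.val_injective hab
      rw [h.right_unique h']
    · obtain ⟨i, j, h, rfl⟩ := mem_arcSet.1 ha
      obtain ⟨k, l, h', rfl⟩ := mem_arcSet.1 hb
      obtain rfl : j = l := Fin.val_injective hab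
      rw [h.left_unique h']
  · have hPQ : arcSet P = arcSet Q := (Prod.mk.inj h).1
    exact setPartition_ext_isArc fun i j => by rw [← mk_mem_arcSet, hPQ, mk_mem_arcSet]
  · rintro ⟨A, O⟩ hx
    simp only [mem_filter, mem_diagrams, IsDiagram, card_eq_zero] at hx
    obtain ⟨⟨h1, -, h2, h3, h4, -⟩, rfl⟩ := hx
    obtain ⟨P, hP⟩ := exists_isArc_iff (fun i j : Fin n => (i.val, j.val) ∈ A)
      (fun i j h => h2 _ h) (fun i j k hj hk => Fin.val_injective (Prod.mk.inj (h3 _ hj _ hk rfl)).2)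
      (fun i j k hi hj => Fin.val_injective (Prod.mk.inj (h4 _ hi _ hj rfl)).1)
    refine ⟨P, mem_univ P, Prod.ext (Finset.ext fun a => ?_) rfl⟩
    rw [mem_arcSet]
    constructor
    · rintro ⟨i, j, h, rfl⟩
      exact (hP i j).1 h
    · exact fun ha => ⟨⟨a.1, (h1 a ha).1⟩, ⟨a.2, (h1 a ha).2⟩, (hP _ _).2 ha, rfl⟩

lemma bell_eq_completions (n : ℕ) : (bell n : ℚ) = completions n 0 := by
  have h := sum_diagrams 1 0 n
  rw [← sum_setPartition n fun s => 1 + 0 * (s : ℚ) ^ 2] at h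
  simpa [bell] using h

/-- `Σ_{λ ∈ Π(n)} i(λ)² = (1/144)((36n²+24n-23)B_n + (72n²+72n-260)B_{n+1}
+ (36n²+156n+489)B_{n+2} - (180n+814)B_{n+3} + 225·B_{n+4})`. -/
theorem sum_inter_sq (n : ℕ) (hn : 1 ≤ n) :
    (∑ P : SetPartition n, (inter P : ℚ) ^ 2) =
      (1 / 144) * ((36 * (n : ℚ) ^ 2 + 24 * n - 23) * bell n
        + (72 * (n : ℚ) ^ 2 + 72 * n - 260) * bell (n + 1)
        + (36 * (n : ℚ) ^ 2 + 156 * n + 489) * bell (n + 2)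
        - (180 * (n : ℚ) + 814) * bell (n + 3)
        + 225 * bell (n + 4)) := by
  have h := sum_diagrams 0 1 n
  rw [← sum_setPartition n fun s => 0 + 1 * (s : ℚ) ^ 2] at h
  simp only [zero_add, one_mul, zero_mul] at h
  simp only [h, completionsInterSq_at_zero, bell_eq_completions]
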